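/- arXiv:0809.4547 — 4 statements merged into one kernel-verified Lean document; each statement's English description precedes it below -/
import Mathlib

section
/- Let L be a Lie algebra over an arbitrary field F with dim L ≤ 3, and let (L_g)_{g ∈ G} be any Lie grading of L. Then there exist a commutative semigroup S and an injective map φ : G → S satisfying property (P), i.e., φ(g)·φ(g') = φ(g'') whenever 0 ≠ [L_g, L_{g'}] ⊆ L_{g''}. -/
/-- The span of all brackets `⁅x, y⁆` with `x ∈ A`, `y ∈ B`: the product `[A, B]`
of two subspaces of a Lie algebra. -/
def bracketSpan (F : Type*) {L : Type*} [Field F] [LieRing L] [LieAlgebra F L]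
    (A B : Submodule F L) : Submodule F L :=
  Submodule.span F {z | ∃ x ∈ A, ∃ y ∈ B, z = ⁅x, y⁆}

/-- A Lie grading of the Lie algebra `L` over `F`: a family of nonzero subspaces,
whose sum is direct and equals `L`, such that for any pair of indices `g, g'` either
`[L_g, L_{g'}] = 0` or `0 ≠ [L_g, L_{g'}] ⊆ L_{g''}` for some index `g''`. -/
def IsLieGrading (F : Type*) {L : Type*} {G : Type*} [Field F] [LieRing L] [LieAlgebra F L]
    (Lg : G → Submodule F L) : Prop :=
  (∀ g, Lg g ≠ ⊥) ∧ iSupIndep Lg ∧ (⨆ g, Lg g) = ⊤ ∧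
    ∀ g g', bracketSpan F (Lg g) (Lg g') = ⊥ ∨
      ∃ g'', bracketSpan F (Lg g) (Lg g') ≠ ⊥ ∧ bracketSpan F (Lg g) (Lg g') ≤ Lg g''

/-- Property (P) for a map `φ` from the index set of a grading into a (multiplicative)
semigroup: `φ g * φ g' = φ g''` whenever `0 ≠ [L_g, L_{g'}] ⊆ L_{g''}`. -/
def PropertyP (F : Type*) {L G S : Type*} [Field F] [LieRing L] [LieAlgebra F L] [Semigroup S]
    (Lg : G → Submodule F L) (φ : G → S) : Prop :=
  ∀ g g' g'', bracketSpan F (Lg g) (Lg g') ≠ ⊥ → bracketSpan F (Lg g) (Lg g') ≤ Lg g'' →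
    φ g * φ g' = φ g''

/-- Property (P) for a map `φ` from the index set of a grading into an additive
semigroup: `φ g + φ g' = φ g''` whenever `0 ≠ [L_g, L_{g'}] ⊆ L_{g''}`. -/
def PropertyPAdd (F : Type*) {L G S : Type*} [Field F] [LieRing L] [LieAlgebra F L]
    [AddSemigroup S] (Lg : G → Submodule F L) (φ : G → S) : Prop :=
  ∀ g g' g'', bracketSpan F (Lg g) (Lg g') ≠ ⊥ → bracketSpan F (Lg g) (Lg g') ≤ Lg g'' →
    φ g + φ g' = φ g''

section

variable {F L G : Type*} [Field F] [LieRing L] [LieAlgebra F L]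

lemma lie_mem_bracketSpan {A B : Submodule F L} {x y : L} (hx : x ∈ A) (hy : y ∈ B) :
    ⁅x, y⁆ ∈ bracketSpan F A B :=
  Submodule.subset_span ⟨x, hx, y, hy, rfl⟩

lemma bracketSpan_comm (A B : Submodule F L) : bracketSpan F A B = bracketSpan F B A := by
  have key : ∀ A B : Submodule F L, bracketSpan F A B ≤ bracketSpan F B A := by
    intro A B
    refine Submodule.span_le.2 ?_
    rintro z ⟨x, hx, y, hy, rfl⟩
    rw [← lie_skew]
    exact neg_mem (lie_mem_bracketSpan hy hx)
  exact le_antisymm (key A B) (key B A)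

lemma bracketSpan_span_singleton_ne_bot {x y : L}
    (h : bracketSpan F (F ∙ x) (F ∙ y) ≠ ⊥) : ⁅x, y⁆ ≠ 0 := by
  intro h0
  refine h (Submodule.span_eq_bot.2 ?_)
  rintro z ⟨u, hu, w, hw, rfl⟩
  obtain ⟨a, rfl⟩ := Submodule.mem_span_singleton.1 hu
  obtain ⟨b, rfl⟩ := Submodule.mem_span_singleton.1 hw
  simp [h0]

lemma exists_eq_span_singleton_of_finrank_eq_one {V : Type*} [AddCommGroup V] [Module F V]
    {A : Submodule F V} (h : Module.finrank F A = 1) : ∃ x, x ≠ 0 ∧ A = F ∙ x := by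
  obtain ⟨x, hx, hA⟩ := finrank_eq_one_iff'.1 h
  refine ⟨x, by simpa using hx, le_antisymm (fun y hy => ?_) (by simp)⟩
  obtain ⟨c, hc⟩ := hA ⟨y, hy⟩
  exact Submodule.mem_span_singleton.2 ⟨c, congrArg Subtype.val hc⟩

lemma bracketSpan_self_eq_bot_of_finrank_eq_one {A : Submodule F L}
    (h : Module.finrank F A = 1) : bracketSpan F A A = ⊥ := by
  obtain ⟨x, -, rfl⟩ := exists_eq_span_singleton_of_finrank_eq_one h
  by_contra hne
  exact bracketSpan_span_singleton_ne_bot hne (lie_self x)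

/-- In a Lie grading, the component containing a nonzero product is unique. -/
lemma IsLieGrading.exists_option {Lg : G → Submodule F L} (h : IsLieGrading F Lg) (g g' : G) :
    ∃ o : Option G, (o = none → bracketSpan F (Lg g) (Lg g') = ⊥) ∧
      (∀ k, o = some k → bracketSpan F (Lg g) (Lg g') ≠ ⊥ ∧
        bracketSpan F (Lg g) (Lg g') ≤ Lg k) ∧
      ∀ k, bracketSpan F (Lg g) (Lg g') ≠ ⊥ → bracketSpan F (Lg g) (Lg g') ≤ Lg k →
        o = some k := by
  rcases h.2.2.2 g g' with h0 | ⟨k, hk0, hk⟩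
  · exact ⟨none, by simp [h0]⟩
  · refine ⟨some k, by simp, ?_, ?_⟩
    · rintro k' ⟨⟩
      exact ⟨hk0, hk⟩
    · intro k' h0 hk'
      by_contra hne
      have hd : Disjoint (Lg k) (Lg k') :=
        h.2.1.pairwiseDisjoint fun e => hne (by rw [e])
      exact h0 (le_bot_iff.1 (hd hk hk'))

/-- The Jacobi identity on structure constants, for `⁅v 1, v 2⁆ = p`, `⁅v 2, v 0⁆ = q` and
`⁅v 0, v 1⁆ = r` in the basis `v`. -/
lemma jacobi_structure_constants {v : Fin 3 → L} (hv : LinearIndependent F v)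
    {p q r : Fin 3 → F} (hp : ⁅v 1, v 2⁆ = ∑ k, p k • v k) (hq : ⁅v 2, v 0⁆ = ∑ k, q k • v k)
    (hr : ⁅v 0, v 1⁆ = ∑ k, r k • v k) (k : Fin 3) :
    (p 1 - q 0) * r k + (r 0 - p 2) * q k + (q 2 - r 1) * p k = 0 := by
  have hj := lie_jacobi (v 0) (v 1) (v 2)
  have h21 := lie_skew (v 2) (v 1)
  have h02 := lie_skew (v 0) (v 2)
  have h10 := lie_skew (v 1) (v 0)
  have hs : ∑ k, ((p 1 - q 0) * r k + (r 0 - p 2) * q k + (q 2 - r 1) * p k) • v k = 0 := by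
    have e : ∑ k, ((p 1 - q 0) * r k + (r 0 - p 2) * q k + (q 2 - r 1) * p k) • v k
        = (p 1 - q 0) • ⁅v 0, v 1⁆ + (r 0 - p 2) • ⁅v 2, v 0⁆ + (q 2 - r 1) • ⁅v 1, v 2⁆ := by
      rw [hp, hq, hr]
      simp only [Fin.sum_univ_three]
      module
    rw [e, ← hj]
    conv_rhs => rw [hp, hq, hr]
    simp only [Fin.sum_univ_three, lie_add, lie_smul, lie_self]
    rw [← h21, ← h02, ← h10]
    module
  exact Fintype.linearIndependent_iff.1 hv _ hs k

/-- A commutative three-element partial multiplication without squares, whose products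
`1 * 2`, `2 * 0`, `0 * 1` are prescribed by the structure constants of a Lie algebra, embeds
into the multiplicative semigroup of some `ZMod n`. -/
lemma exists_zmod_of_jacobi (P Q R : Option (Fin 3)) {a b c : F} (ha : a ≠ 0) (hb : b ≠ 0)
    (hc : c ≠ 0)
    (h : ∀ k, ((if P = some 1 then a else 0) - (if Q = some 0 then b else 0)) *
          (if R = some k then c else 0) +
        ((if R = some 0 then c else 0) - (if P = some 2 then a else 0)) *
          (if Q = some k then b else 0) +
        ((if Q = some 2 then b else 0) - (if R = some 1 then c else 0)) *
          (if P = some k then a else 0) = 0) :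
    ∃ (n : ℕ) (f : Fin 3 → ZMod n), Function.Injective f ∧
      (∀ k, P = some k → f 1 * f 2 = f k) ∧ (∀ k, Q = some k → f 2 * f 0 = f k) ∧
      (∀ k, R = some k → f 0 * f 1 = f k) := by
  have h0 := h 0
  have h1 := h 1
  have h2 := h 2
  clear h
  rcases P with _ | P <;> rcases Q with _ | Q <;> rcases R with _ | R <;>
    (try fin_cases P) <;> (try fin_cases Q) <;> (try fin_cases R) <;>
    first
    | exact ⟨16, ![0, 4, 8], by decide, by decide, by decide, by decide⟩
    | exact ⟨16, ![4, 0, 8], by decide, by decide, by decide, by decide⟩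
    | exact ⟨16, ![4, 8, 0], by decide, by decide, by decide, by decide⟩
    | exact ⟨8, ![3, 5, 7], by decide, by decide, by decide, by decide⟩
    | exact ⟨7, ![1, 2, 4], by decide, by decide, by decide, by decide⟩
    | exact ⟨7, ![2, 1, 4], by decide, by decide, by decide, by decide⟩
    | exact ⟨7, ![2, 4, 1], by decide, by decide, by decide, by decide⟩
    | (exfalso; simp [ha, hb, hc] at h0 h1 h2 <;> grind)

lemma exists_zmod_fin_two (P Q : Option (Fin 2)) :
    ∃ (n : ℕ) (f : Fin 2 → ZMod n), Function.Injective f ∧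
      (∀ k, P = some k → f 0 * f 0 = f k) ∧ (∀ k, Q = some k → f 0 * f 1 = f k) := by
  rcases P with _ | P <;> rcases Q with _ | Q <;>
    (try fin_cases P) <;> (try fin_cases Q) <;>
    first
    | exact ⟨16, ![0, 4], by decide, by decide, by decide⟩
    | exact ⟨16, ![4, 0], by decide, by decide, by decide⟩
    | exact ⟨3, ![1, 2], by decide, by decide, by decide⟩
    | exact ⟨3, ![2, 1], by decide, by decide, by decide⟩

/-- An injective map into some `ZMod n` satisfying property (P) after relabelling the index set
gives a commutative semigroup as required. -/
lemma exists_commSemigroup_of_zmod {ι : Type*} {Lg : G → Submodule F L} (e : ι ≃ G) {n : ℕ}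
    {f : ι → ZMod n} (hf : Function.Injective f)
    (h : ∀ i j k, bracketSpan F (Lg (e i)) (Lg (e j)) ≠ ⊥ →
      bracketSpan F (Lg (e i)) (Lg (e j)) ≤ Lg (e k) → f i * f j = f k) :
    ∃ (S : Type) (inst : CommSemigroup S) (φ : G → S), Function.Injective φ ∧
      @PropertyP F L G S _ _ _ inst.toSemigroup Lg φ := by
  refine ⟨ZMod n, inferInstance, f ∘ e.symm, hf.comp e.symm.injective, ?_⟩
  intro g g' g'' h0 h1
  exact h _ _ _ (by simpa using h0) (by simpa using h1)

lemma IsLieGrading.exists_of_fin_two [FiniteDimensional F L] (hdim : Module.finrank F L ≤ 3)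
    {Lg : G → Submodule F L} (h : IsLieGrading F Lg) (e : Fin 2 ≃ G) :
    ∃ (S : Type) (inst : CommSemigroup S) (φ : G → S), Function.Injective φ ∧
      @PropertyP F L G S _ _ _ inst.toSemigroup Lg φ := by
  have key : ∀ e : Fin 2 ≃ G, Module.finrank F (Lg (e 1)) = 1 →
      ∃ (S : Type) (inst : CommSemigroup S) (φ : G → S), Function.Injective φ ∧
        @PropertyP F L G S _ _ _ inst.toSemigroup Lg φ := by
    intro e he
    have h11 := bracketSpan_self_eq_bot_of_finrank_eq_one he
    obtain ⟨P, -, -, hP⟩ := h.exists_option (e 0) (e 0)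
    obtain ⟨Q, -, -, hQ⟩ := h.exists_option (e 0) (e 1)
    obtain ⟨n, f, hf, hfP, hfQ⟩ := exists_zmod_fin_two (P.map e.symm) (Q.map e.symm)
    refine exists_commSemigroup_of_zmod e hf fun i j k h0 h1 => ?_
    fin_cases i <;> fin_cases j
    · exact hfP k (by simp [hP _ h0 h1])
    · exact hfQ k (by simp [hQ _ h0 h1])
    · rw [bracketSpan_comm] at h0 h1
      rw [mul_comm]
      exact hfQ k (by simp [hQ _ h0 h1])
    · exact absurd h11 h0
  have hd : Disjoint (Lg (e 0)) (Lg (e 1)) := h.2.1.pairwiseDisjoint (by simp)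
  have hs := Submodule.finrank_add_finrank_le_of_disjoint hd
  have p0 := Submodule.one_le_finrank_iff.2 (h.1 (e 0))
  have p1 := Submodule.one_le_finrank_iff.2 (h.1 (e 1))
  rcases (by omega : Module.finrank F (Lg (e 1)) = 1 ∨ Module.finrank F (Lg (e 0)) = 1)
    with h1 | h1
  · exact key e h1
  · exact key ((Equiv.swap 0 1).trans e)
      (by rwa [Equiv.trans_apply, Equiv.swap_apply_right])

lemma IsLieGrading.exists_of_fin_three [FiniteDimensional F L] (hdim : Module.finrank F L ≤ 3)
    {Lg : G → Submodule F L} (h : IsLieGrading F Lg) (e : Fin 3 ≃ G) :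
    ∃ (S : Type) (inst : CommSemigroup S) (φ : G → S), Function.Injective φ ∧
      @PropertyP F L G S _ _ _ inst.toSemigroup Lg φ := by
  have hind : iSupIndep (Lg ∘ e) := h.2.1.comp e.injective
  have hone : ∀ i, Module.finrank F (Lg (e i)) = 1 := by
    have hpos : ∀ i, 1 ≤ Module.finrank F (Lg (e i)) := fun i =>
      Submodule.one_le_finrank_iff.2 (h.1 (e i))
    have d01 : Disjoint (Lg (e 0)) (Lg (e 1)) := hind.pairwiseDisjoint (by simp)
    have d2 : Disjoint (Lg (e 2)) (Lg (e 0) ⊔ Lg (e 1)) := by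
      refine (hind 2).mono_right (sup_le ?_ ?_)
      · exact le_iSup₂_of_le (f := fun j (_ : j ≠ 2) => (Lg ∘ e) j) 0 (by decide) le_rfl
      · exact le_iSup₂_of_le (f := fun j (_ : j ≠ 2) => (Lg ∘ e) j) 1 (by decide) le_rfl
    have s1 := Submodule.finrank_sup_add_finrank_inf_eq (Lg (e 0)) (Lg (e 1))
    rw [d01.eq_bot, finrank_bot] at s1
    have s2 := Submodule.finrank_add_finrank_le_of_disjoint d2
    have p0 := hpos 0
    have p1 := hpos 1
    have p2 := hpos 2
    intro i
    fin_cases i <;> simp only [Fin.zero_eta, Fin.mk_one, Fin.reduceFinMk] <;> omega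
  choose v hv0 hv using fun i => exists_eq_span_singleton_of_finrank_eq_one (hone i)
  have hvi : LinearIndependent F v :=
    hind.linearIndependent _ (fun i => by
      rw [Function.comp_apply, hv]; exact Submodule.mem_span_singleton_self _) hv0
  have hb : ∀ i j, ∃ (o : Option (Fin 3)) (a : F), a ≠ 0 ∧
      ⁅v i, v j⁆ = ∑ k, (if o = some k then a else 0) • v k ∧
      ∀ k, bracketSpan F (Lg (e i)) (Lg (e j)) ≠ ⊥ →
        bracketSpan F (Lg (e i)) (Lg (e j)) ≤ Lg (e k) → o = some k := by
    intro i j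
    have hmem : ⁅v i, v j⁆ ∈ bracketSpan F (Lg (e i)) (Lg (e j)) :=
      lie_mem_bracketSpan (by rw [hv]; exact Submodule.mem_span_singleton_self _)
        (by rw [hv]; exact Submodule.mem_span_singleton_self _)
    obtain ⟨o, hn, hs, hu⟩ := h.exists_option (e i) (e j)
    rcases o with _ | g
    · refine ⟨none, 1, one_ne_zero, ?_, fun k h0 _ => absurd (hn rfl) h0⟩
      rw [hn rfl, Submodule.mem_bot] at hmem
      simp [hmem]
    · obtain ⟨h0, hle⟩ := hs g rfl
      obtain ⟨k, rfl⟩ := e.surjective g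
      have hmem' := hle hmem
      rw [hv k] at hmem'
      obtain ⟨a, ha⟩ := Submodule.mem_span_singleton.1 hmem'
      have hne : ⁅v i, v j⁆ ≠ 0 := by
        rw [hv i, hv j] at h0
        exact bracketSpan_span_singleton_ne_bot h0
      refine ⟨some k, a, ?_, ?_, fun k' h0 h1 => ?_⟩
      · rintro rfl
        exact hne (by simpa using ha.symm)
      · simp [ha]
      · simpa using hu (e k') h0 h1
  obtain ⟨P, a, ha, hP, hP'⟩ := hb 1 2
  obtain ⟨Q, b, hb0, hQ, hQ'⟩ := hb 2 0
  obtain ⟨R, c, hc, hR, hR'⟩ := hb 0 1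
  obtain ⟨n, f, hf, hfP, hfQ, hfR⟩ :=
    exists_zmod_of_jacobi P Q R ha hb0 hc (jacobi_structure_constants hvi hP hQ hR)
  refine exists_commSemigroup_of_zmod e hf fun i j k h0 h1 => ?_
  have hself := fun i => bracketSpan_self_eq_bot_of_finrank_eq_one (hone i)
  fin_cases i <;> fin_cases j
  · exact absurd (hself 0) h0
  · exact hfR k (hR' k h0 h1)
  · rw [bracketSpan_comm] at h0 h1
    rw [mul_comm]
    exact hfQ k (hQ' k h0 h1)
  · rw [bracketSpan_comm] at h0 h1
    rw [mul_comm]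
    exact hfR k (hR' k h0 h1)
  · exact absurd (hself 1) h0
  · exact hfP k (hP' k h0 h1)
  · exact hfQ k (hQ' k h0 h1)
  · rw [bracketSpan_comm] at h0 h1
    rw [mul_comm]
    exact hfP k (hP' k h0 h1)
  · exact absurd (hself 2) h0

/-- A Lie grading has at most `dim L` components. -/
lemma IsLieGrading.exists_equiv_fin [FiniteDimensional F L]
    {Lg : G → Submodule F L} (h : IsLieGrading F Lg) :
    ∃ n ≤ Module.finrank F L, Nonempty (Fin n ≃ G) := by
  have hex : ∀ g, ∃ x ∈ Lg g, x ≠ 0 := fun g => Submodule.exists_mem_ne_zero_of_ne_bot (h.1 g)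
  choose v hv hv0 using hex
  have hvi : LinearIndependent F v := h.2.1.linearIndependent _ hv hv0
  have : Finite G := hvi.finite
  have := Fintype.ofFinite G
  exact ⟨Fintype.card G, hvi.fintype_card_le_finrank, ⟨(Fintype.equivFin G).symm⟩⟩

end

/-- For any Lie grading of a Lie algebra of dimension at most `3` over an arbitrary
field, there exist a commutative semigroup `S` and an injective map `φ` of the index set
into `S` satisfying property (P). -/
theorem grading_of_dim_le_three_is_semigroup_grading
    {F L : Type*} [Field F] [LieRing L] [LieAlgebra F L] [FiniteDimensional F L]
    (hdim : Module.finrank F L ≤ 3)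
    {G : Type*} (Lg : G → Submodule F L) (hgrad : IsLieGrading F Lg) :
    ∃ (S : Type) (inst : CommSemigroup S) (φ : G → S), Function.Injective φ ∧
      @PropertyP F L G S _ _ _ inst.toSemigroup Lg φ := by
  obtain ⟨n, hn, ⟨e⟩⟩ := hgrad.exists_equiv_fin
  obtain hn1 | rfl | rfl : n ≤ 1 ∨ n = 2 ∨ n = 3 := by omega
  · have : Subsingleton (Fin n) := Fin.subsingleton_iff_le_one.2 hn1
    exact exists_commSemigroup_of_zmod e (n := 1) (f := fun _ => 0)
      (Function.injective_of_subsingleton _) fun _ _ _ _ _ => mul_zero 0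
  · exact hgrad.exists_of_fin_two hdim e
  · exact hgrad.exists_of_fin_three hdim e
end

section
/- Let M be the 3-dimensional Lie algebra over a field F with basis {x, y, z} and brackets [x,z] = z, [y,z] = z, [x,y] = 0. Then the decomposition M = span{x} ⊕ span{y} ⊕ span{z} is a Lie grading of M, but there is no group H and injective map φ from the 3-element index set into H satisfying property (P). Thus this Lie grading is not a group grading. -/
theorem bracketSpan_span_singleton (F : Type*) {L : Type*} [Field F] [LieRing L]
    [LieAlgebra F L] (a b : L) :
    bracketSpan F (Submodule.span F {a}) (Submodule.span F {b}) = Submodule.span F {⁅a, b⁆} := by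
  apply le_antisymm
  · refine Submodule.span_le.2 ?_
    rintro _ ⟨u, hu, v, hv, rfl⟩
    obtain ⟨c, rfl⟩ := Submodule.mem_span_singleton.1 hu
    obtain ⟨d, rfl⟩ := Submodule.mem_span_singleton.1 hv
    rw [smul_lie, lie_smul]
    exact Submodule.smul_mem _ _ (Submodule.smul_mem _ _ (Submodule.mem_span_singleton_self _))
  · refine (Submodule.span_singleton_le_iff_mem _ _).2 (Submodule.subset_span ?_)
    exact ⟨a, Submodule.mem_span_singleton_self a, b, Submodule.mem_span_singleton_self b, rfl⟩

/-- `M` is the 3-dimensional Lie algebra with basis `{x, y, z}` and brackets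
`⁅x,z⁆ = z`, `⁅y,z⁆ = z`, `⁅x,y⁆ = 0`.  The decomposition
`M = span{x} ⊕ span{y} ⊕ span{z}` is a Lie grading of `M`, but there is no group `H`
and injective map `φ` of the 3-element index set into `H` satisfying property (P);
thus this Lie grading is not a group grading. -/
theorem M_grading_not_group_grading {F L : Type*} [Field F] [LieRing L] [LieAlgebra F L]
    (x y z : L)
    (hind : LinearIndependent F ![x, y, z])
    (hspan : Submodule.span F {x, y, z} = ⊤)
    (hxz : ⁅x, z⁆ = z) (hyz : ⁅y, z⁆ = z) (hxy : ⁅x, y⁆ = 0) :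
    IsLieGrading F ![Submodule.span F {x}, Submodule.span F {y}, Submodule.span F {z}] ∧
    ∀ (H : Type*) [Group H] (φ : Fin 3 → H), Function.Injective φ →
      ¬ PropertyP F ![Submodule.span F {x}, Submodule.span F {y}, Submodule.span F {z}] φ := by
  have hz : z ≠ 0 := hind.ne_zero 2
  have hyx : ⁅y, x⁆ = 0 := by rw [← lie_skew, hxy, neg_zero]
  have hzx : ⁅z, x⁆ = -z := by rw [← lie_skew, hxz]
  have hzy : ⁅z, y⁆ = -z := by rw [← lie_skew, hyz]
  have hfam : ![Submodule.span F {x}, Submodule.span F {y}, Submodule.span F {z}] =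
      fun i => Submodule.span F {![x, y, z] i} := by
    funext i
    fin_cases i <;> rfl
  rw [hfam]
  refine ⟨⟨fun i => ?_, hind.iSupIndep_span_singleton, ?_, fun i j => ?_⟩, ?_⟩
  · exact mt Submodule.span_singleton_eq_bot.1 (hind.ne_zero i)
  · rw [← Submodule.span_range_eq_iSup, ← hspan]
    simp only [Matrix.range_cons, Matrix.range_empty, Set.union_empty, Set.singleton_union]
  · rw [bracketSpan_span_singleton, Submodule.span_singleton_eq_bot]
    refine or_iff_not_imp_left.2 fun h => ⟨2, mt Submodule.span_singleton_eq_bot.1 h,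
      (Submodule.span_singleton_le_iff_mem _ _).2 ?_⟩
    fin_cases i <;> fin_cases j <;>
      simp [hxy, hxz, hyz, hyx, hzx, hzy, Submodule.mem_span_singleton_self]
  · intro H _ φ hφ hP
    have key (i : Fin 3) (hi : ⁅![x, y, z] i, z⁆ = z) : φ i = 1 := by
      refine mul_eq_right.1 (hP i 2 2 ?_ ?_) <;> rw [bracketSpan_span_singleton]
      · exact mt Submodule.span_singleton_eq_bot.1 (hi.trans_ne hz)
      · exact (congrArg (fun w => Submodule.span F {w}) hi).le
    exact absurd (hφ ((key 0 hxz).trans (key 1 hyz).symm)) (by decide)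
end

section
/- The decomposition L₂ = span{h, e₁} ⊕ span{x} ⊕ span{y} ⊕ span{e₂} ⊕ span{e₃} is a Lie grading of L₂; concretely: the five subspaces are nonzero, their sum is direct and equals L₂, [span{h,e₁}, span{x}] = span{x}, [span{h,e₁}, span{y}] = span{y}, [span{x}, span{y}] = span{h} ⊆ span{h,e₁}, [span{h,e₁}, span{e₂}] = span{e₃}, [span{h,e₁}, span{e₃}] = span{e₂}, [span{e₂}, span{e₃}] = span{e₁} ⊆ span{h,e₁}, [span{h,e₁}, span{h,e₁}] = 0, and all brackets between one of span{x}, span{y} and one of span{e₂}, span{e₃} are 0. -/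
/-- The product of two spans is spanned by the brackets of the generators. -/
lemma bracketSpan_span_span {F L : Type*} [Field F] [LieRing L] [LieAlgebra F L] (s t : Set L) :
    bracketSpan F (Submodule.span F s) (Submodule.span F t) =
      Submodule.span F (Set.image2 (fun a b => ⁅a, b⁆) s t) := by
  have hmap : bracketSpan F (Submodule.span F s) (Submodule.span F t) =
      Submodule.map₂ (LieModule.toEnd F L L : L →ₗ[F] L →ₗ[F] L)
        (Submodule.span F s) (Submodule.span F t) := by
    refine le_antisymm (Submodule.span_le.2 ?_) (Submodule.map₂_le.2 ?_)
    · rintro _ ⟨a, ha, b, hb, rfl⟩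
      exact Submodule.apply_mem_map₂ (LieModule.toEnd F L L : L →ₗ[F] L →ₗ[F] L) ha hb
    · exact fun a ha b hb => Submodule.subset_span ⟨a, ha, b, hb, rfl⟩
  rw [hmap, Submodule.map₂_span_span]
  rfl

/-- Sorting a linearly independent family into blocks yields independent spans. -/
lemma LinearIndependent.iSupIndep_span_image_fiber {R M ι G : Type*} [Ring R] [AddCommGroup M]
    [Module R M] {v : ι → M} (hv : LinearIndependent R v) (f : ι → G) :
    iSupIndep fun g => Submodule.span R (v '' (f ⁻¹' {g})) := by
  intro g
  refine (hv.disjoint_span_image (s := f ⁻¹' {g}) (t := f ⁻¹' {g}ᶜ) ?_).mono_right ?_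
  · exact Disjoint.preimage f disjoint_compl_right
  · refine iSup₂_le fun j hj => Submodule.span_mono (Set.image_mono ?_)
    rintro i rfl
    exact hj

/-- `L₂ = J ⊕ K` where `J` has basis `{h, x, y}` with `⁅h,x⁆ = x`, `⁅h,y⁆ = -y`,
`⁅x,y⁆ = h`, and `K` has basis `{e₁, e₂, e₃}` with `⁅e₁,e₂⁆ = e₃`, `⁅e₂,e₃⁆ = e₁`,
`⁅e₃,e₁⁆ = e₂` (all brackets between `J` and `K` vanish).  The decomposition
`L₂ = span{h,e₁} ⊕ span{x} ⊕ span{y} ⊕ span{e₂} ⊕ span{e₃}` is a Lie grading of `L₂`,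
with the concrete bracket relations listed. -/
theorem L2_grading_isLieGrading
    {F L : Type*} [Field F] [LieRing L] [LieAlgebra F L]
    (h x y e₁ e₂ e₃ : L)
    (hind : LinearIndependent F ![h, x, y, e₁, e₂, e₃])
    (hspan : Submodule.span F {h, x, y, e₁, e₂, e₃} = ⊤)
    (hhx : ⁅h, x⁆ = x) (hhy : ⁅h, y⁆ = -y) (hxy : ⁅x, y⁆ = h)
    (he12 : ⁅e₁, e₂⁆ = e₃) (he23 : ⁅e₂, e₃⁆ = e₁) (he31 : ⁅e₃, e₁⁆ = e₂)
    (hhe1 : ⁅h, e₁⁆ = 0) (hhe2 : ⁅h, e₂⁆ = 0) (hhe3 : ⁅h, e₃⁆ = 0)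
    (hxe1 : ⁅x, e₁⁆ = 0) (hxe2 : ⁅x, e₂⁆ = 0) (hxe3 : ⁅x, e₃⁆ = 0)
    (hye1 : ⁅y, e₁⁆ = 0) (hye2 : ⁅y, e₂⁆ = 0) (hye3 : ⁅y, e₃⁆ = 0)
    :
    IsLieGrading F ![Submodule.span F {h, e₁}, Submodule.span F {x}, Submodule.span F {y},
      Submodule.span F {e₂}, Submodule.span F {e₃}] ∧
    (Submodule.span F {h, e₁} ≠ (⊥ : Submodule F L) ∧
      Submodule.span F {x} ≠ (⊥ : Submodule F L) ∧
      Submodule.span F {y} ≠ (⊥ : Submodule F L) ∧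
      Submodule.span F {e₂} ≠ (⊥ : Submodule F L) ∧
      Submodule.span F {e₃} ≠ (⊥ : Submodule F L)) ∧
    iSupIndep ![Submodule.span F {h, e₁}, Submodule.span F {x}, Submodule.span F {y},
      Submodule.span F {e₂}, Submodule.span F {e₃}] ∧
    Submodule.span F {h, e₁} ⊔ Submodule.span F {x} ⊔ Submodule.span F {y} ⊔
      Submodule.span F {e₂} ⊔ Submodule.span F {e₃} = ⊤ ∧
    bracketSpan F (Submodule.span F {h, e₁}) (Submodule.span F {x}) = Submodule.span F {x} ∧
    bracketSpan F (Submodule.span F {h, e₁}) (Submodule.span F {y}) = Submodule.span F {y} ∧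
    bracketSpan F (Submodule.span F {x}) (Submodule.span F {y}) = Submodule.span F {h} ∧
    Submodule.span F {h} ≤ Submodule.span F {h, e₁} ∧
    bracketSpan F (Submodule.span F {h, e₁}) (Submodule.span F {e₂}) = Submodule.span F {e₃} ∧
    bracketSpan F (Submodule.span F {h, e₁}) (Submodule.span F {e₃}) = Submodule.span F {e₂} ∧
    bracketSpan F (Submodule.span F {e₂}) (Submodule.span F {e₃}) = Submodule.span F {e₁} ∧
    Submodule.span F {e₁} ≤ Submodule.span F {h, e₁} ∧
    bracketSpan F (Submodule.span F {h, e₁}) (Submodule.span F {h, e₁}) = ⊥ ∧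
    bracketSpan F (Submodule.span F {x}) (Submodule.span F {e₂}) = ⊥ ∧
    bracketSpan F (Submodule.span F {x}) (Submodule.span F {e₃}) = ⊥ ∧
    bracketSpan F (Submodule.span F {y}) (Submodule.span F {e₂}) = ⊥ ∧
    bracketSpan F (Submodule.span F {y}) (Submodule.span F {e₃}) = ⊥ := by
  have hh0 : h ≠ 0 := hind.ne_zero 0
  have hx0 : x ≠ 0 := hind.ne_zero 1
  have hy0 : y ≠ 0 := hind.ne_zero 2
  have h10 : e₁ ≠ 0 := hind.ne_zero 3
  have h20 : e₂ ≠ 0 := hind.ne_zero 4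
  have h30 : e₃ ≠ 0 := hind.ne_zero 5
  have swap {a b c : L} (hab : ⁅a, b⁆ = c) : ⁅b, a⁆ = -c := by rw [← lie_skew, hab]
  have hxh := swap hhx
  have hyh := swap hhy
  have hyx := swap hxy
  have he21 := swap he12
  have he32 := swap he23
  have he13 := swap he31
  have he1h := swap hhe1
  have he2h := swap hhe2
  have he3h := swap hhe3
  have he1x := swap hxe1
  have he2x := swap hxe2
  have he3x := swap hxe3
  have he1y := swap hye1
  have he2y := swap hye2
  have he3y := swap hye3
  clear swap
  have pair_zero (z : L) : Submodule.span F {z, 0} = Submodule.span F {z} := by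
    rw [Set.pair_comm, Submodule.span_insert_zero]
  have span_neg_singleton (z : L) : Submodule.span F {-z} = Submodule.span F {z} := by
    rw [← Set.neg_singleton, Submodule.span_neg]
  have hne : Submodule.span F {h, e₁} ≠ (⊥ : Submodule F L) ∧
      Submodule.span F {x} ≠ (⊥ : Submodule F L) ∧
      Submodule.span F {y} ≠ (⊥ : Submodule F L) ∧
      Submodule.span F {e₂} ≠ (⊥ : Submodule F L) ∧
      Submodule.span F {e₃} ≠ (⊥ : Submodule F L) := by
    simp [Submodule.span_eq_bot, *]
  have hindep : iSupIndep ![Submodule.span F {h, e₁}, Submodule.span F {x}, Submodule.span F {y},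
      Submodule.span F {e₂}, Submodule.span F {e₃}] := by
    convert hind.iSupIndep_span_image_fiber (![0, 1, 2, 0, 3, 4] : Fin 6 → Fin 5) using 1
    funext g
    have him : ∀ s : Set (Fin 6), ![h, x, y, e₁, e₂, e₃] '' s =
        {z | (0 ∈ s ∧ h = z) ∨ (1 ∈ s ∧ x = z) ∨ (2 ∈ s ∧ y = z) ∨ (3 ∈ s ∧ e₁ = z) ∨
          (4 ∈ s ∧ e₂ = z) ∨ (5 ∈ s ∧ e₃ = z)} := by
      intro s
      ext z
      simp [Fin.exists_fin_succ]
    rw [him]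
    fin_cases g <;> refine congrArg (Submodule.span F) (Set.ext fun z => ?_) <;>
      simp [eq_comm]
  have hsup : Submodule.span F {h, e₁} ⊔ Submodule.span F {x} ⊔ Submodule.span F {y} ⊔
      Submodule.span F {e₂} ⊔ Submodule.span F {e₃} = ⊤ := by
    simp only [← Submodule.span_union]
    rw [← hspan]
    congr 1
    ext z
    simp only [Set.mem_union, Set.mem_insert_iff, Set.mem_singleton_iff]
    tauto
  refine ⟨⟨?_, hindep, ?_, ?_⟩, hne, hindep, hsup, ?_⟩
  · obtain ⟨h₀, h₁, h₂, h₃, h₄⟩ := hne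
    intro g
    fin_cases g <;> assumption
  · rw [eq_top_iff, ← hsup]
    exact sup_le (sup_le (sup_le (sup_le (le_iSup_of_le 0 le_rfl) (le_iSup_of_le 1 le_rfl))
      (le_iSup_of_le 2 le_rfl)) (le_iSup_of_le 3 le_rfl)) (le_iSup_of_le 4 le_rfl)
  · suffices hle : ∀ g g', ∃ g'', bracketSpan F
        (![Submodule.span F {h, e₁}, Submodule.span F {x}, Submodule.span F {y},
          Submodule.span F {e₂}, Submodule.span F {e₃}] g)
        (![Submodule.span F {h, e₁}, Submodule.span F {x}, Submodule.span F {y},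
          Submodule.span F {e₂}, Submodule.span F {e₃}] g') ≤
        ![Submodule.span F {h, e₁}, Submodule.span F {x}, Submodule.span F {y},
          Submodule.span F {e₂}, Submodule.span F {e₃}] g'' by
      intro g g'
      obtain ⟨g'', hg⟩ := hle g g'
      exact or_iff_not_imp_left.2 fun hb => ⟨g'', hb, hg⟩
    have hh_mem : h ∈ Submodule.span F {h, e₁} := Submodule.subset_span (by simp)
    have he1_mem : e₁ ∈ Submodule.span F {h, e₁} := Submodule.subset_span (by simp)
    intro g g'
    refine ⟨(![![0, 1, 2, 4, 3], ![1, 0, 0, 0, 0], ![2, 0, 0, 0, 0], ![4, 0, 0, 0, 0],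
      ![3, 0, 0, 0, 0]] : Fin 5 → Fin 5 → Fin 5) g g', ?_⟩
    fin_cases g <;> fin_cases g' <;>
      simp [bracketSpan_span_span, Submodule.span_le, Set.insert_subset_iff,
        Submodule.mem_span_singleton_self, *]
  · simp [bracketSpan_span_span, Set.image_pair,
      Submodule.span_mono, Submodule.span_insert_zero, *]
end

section
/- For the Lie grading of L₂ by the index set G = {α, β, γ, δ, μ} with components (L₂)_α = span{h, e₁}, (L₂)_β = span{x}, (L₂)_γ = span{y}, (L₂)_δ = span{e₂}, (L₂)_μ = span{e₃}, there is no semigroup S and injective map φ : G → S satisfying property (P). Thus this Lie grading is not a semigroup grading. -/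
theorem bracketSpan_span_le {F L : Type*} [Field F] [LieRing L] [LieAlgebra F L]
    {s t : Set L} {W : Submodule F L} (H : ∀ a ∈ s, ∀ b ∈ t, ⁅a, b⁆ ∈ W) :
    bracketSpan F (Submodule.span F s) (Submodule.span F t) ≤ W := by
  refine Submodule.span_le.2 ?_
  rintro _ ⟨a, ha, b, hb, rfl⟩
  have hle : Submodule.map₂ (LieModule.toEnd F L L : L →ₗ[F] Module.End F L)
      (Submodule.span F s) (Submodule.span F t) ≤ W := by
    rw [Submodule.map₂_span_span, Submodule.span_le]
    rintro _ ⟨a, ha, b, hb, rfl⟩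
    exact H a ha b hb
  exact hle (Submodule.apply_mem_map₂ _ ha hb)

theorem bracketSpan_ne_bot {F L : Type*} [Field F] [LieRing L] [LieAlgebra F L]
    {A B : Submodule F L} {a b : L} (ha : a ∈ A) (hb : b ∈ B) (hab : ⁅a, b⁆ ≠ 0) :
    bracketSpan F A B ≠ ⊥ :=
  (Submodule.ne_bot_iff _).2 ⟨_, Submodule.subset_span ⟨a, ha, b, hb, rfl⟩, hab⟩

/-- If `[a, b] ≠ 0` for some generators of two components, and every bracket of generators
lies in a third component, then property (P) multiplies the corresponding indices. -/
theorem PropertyP.mul_eq {F L G S : Type*} [Field F] [LieRing L] [LieAlgebra F L] [Semigroup S]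
    {Lg : G → Submodule F L} {φ : G → S} (hP : PropertyP F Lg φ) {g g' g'' : G} {s t : Set L}
    (hg : Lg g = Submodule.span F s) (hg' : Lg g' = Submodule.span F t)
    {a b : L} (ha : a ∈ s) (hb : b ∈ t) (hab : ⁅a, b⁆ ≠ 0)
    (H : ∀ a ∈ s, ∀ b ∈ t, ⁅a, b⁆ ∈ Lg g'') : φ g * φ g' = φ g'' := by
  apply hP
  · rw [hg, hg']
    exact bracketSpan_ne_bot (Submodule.subset_span ha) (Submodule.subset_span hb) hab
  · rw [hg, hg']
    exact bracketSpan_span_le H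

/-- The Lie grading of `L₂ = J ⊕ K` with components `span{h,e₁}`, `span{x}`, `span{y}`,
`span{e₂}`, `span{e₃}` is not a semigroup grading: there is no semigroup `S` and
injective map `φ` of the index set into `S` satisfying property (P). -/
theorem L2_grading_not_semigroup
    {F L : Type*} [Field F] [LieRing L] [LieAlgebra F L]
    (h x y e₁ e₂ e₃ : L)
    (hind : LinearIndependent F ![h, x, y, e₁, e₂, e₃])
    (hspan : Submodule.span F {h, x, y, e₁, e₂, e₃} = ⊤)
    (hhx : ⁅h, x⁆ = x) (hhy : ⁅h, y⁆ = -y) (hxy : ⁅x, y⁆ = h)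
    (he12 : ⁅e₁, e₂⁆ = e₃) (he23 : ⁅e₂, e₃⁆ = e₁) (he31 : ⁅e₃, e₁⁆ = e₂)
    (hhe1 : ⁅h, e₁⁆ = 0) (hhe2 : ⁅h, e₂⁆ = 0) (hhe3 : ⁅h, e₃⁆ = 0)
    (hxe1 : ⁅x, e₁⁆ = 0) (hxe2 : ⁅x, e₂⁆ = 0) (hxe3 : ⁅x, e₃⁆ = 0)
    (hye1 : ⁅y, e₁⁆ = 0) (hye2 : ⁅y, e₂⁆ = 0) (hye3 : ⁅y, e₃⁆ = 0)
    :
    ∀ (S : Type*) [Semigroup S] (φ : Fin 5 → S), Function.Injective φ →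
      ¬ PropertyP F ![Submodule.span F {h, e₁}, Submodule.span F {x}, Submodule.span F {y},
        Submodule.span F {e₂}, Submodule.span F {e₃}] φ := by
  intro S _ φ hφ hP
  have hh0 : h ≠ 0 := hind.ne_zero 0
  have hx0 : x ≠ 0 := hind.ne_zero 1
  have he20 : e₂ ≠ 0 := hind.ne_zero 4
  have he30 : e₃ ≠ 0 := hind.ne_zero 5
  have he1x : ⁅e₁, x⁆ = 0 := by rw [← lie_skew, hxe1, neg_zero]
  have he13 : ⁅e₁, e₃⁆ = -e₂ := by rw [← lie_skew, he31]
  have hαβ : φ 0 * φ 1 = φ 1 :=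
    hP.mul_eq (s := {h, e₁}) (t := {x}) rfl rfl (a := h) (b := x) (by simp) (by simp)
      (by rwa [hhx]) (by simp [hhx, he1x, Submodule.mem_span_singleton_self])
  have hβγ : φ 1 * φ 2 = φ 0 :=
    hP.mul_eq (s := {x}) (t := {y}) rfl rfl (a := x) (b := y) (by simp) (by simp)
      (by rwa [hxy]) (by simpa [hxy] using Submodule.subset_span (by simp))
  have hαδ : φ 0 * φ 3 = φ 4 :=
    hP.mul_eq (s := {h, e₁}) (t := {e₂}) rfl rfl (a := e₁) (b := e₂) (by simp) (by simp)
      (by rwa [he12]) (by simp [hhe2, he12, Submodule.mem_span_singleton_self])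
  have hαμ : φ 0 * φ 4 = φ 3 :=
    hP.mul_eq (s := {h, e₁}) (t := {e₃}) rfl rfl (a := e₁) (b := e₃) (by simp) (by simp)
      (by rwa [he13, neg_ne_zero]) (by simp [hhe3, he13, Submodule.mem_span_singleton_self])
  have hαα : φ 0 * φ 0 = φ 0 := by
    nth_rw 2 [← hβγ]
    rw [← mul_assoc, hαβ, hβγ]
  have hδμ : φ 3 = φ 4 := by
    rw [← hαμ, ← hαδ, ← mul_assoc, hαα]
  exact absurd (hφ hδμ) (by decide)
end
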